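/- arXiv:2509.20505 — 3 statements merged into one kernel-verified Lean document; each statement's English description precedes it below -/
import Mathlib

section
/- Let κ > 0 and ξ = (ξ₁,ξ₂,ξ₃) ∈ ℝ³ with ξ ≠ 0, and let M(ξ) be the 4×4 complex matrix whose rows are (0, −|ξ|, 0, 0), (|ξ|, 0, κ⁻¹, 0), (0, −κ⁻¹, 0, iκ⁻¹ξ₃/|ξ|) and (−iξ₃, 0, 0, 0). Then the characteristic polynomial det(τ·I₄ − M(ξ)) of M(ξ), as a polynomial in τ, equals τ⁴ + (κ⁻² + |ξ|²)τ² + κ⁻²ξ₃². -/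
open Polynomial

/-- The characteristic polynomial of a `4 × 4` matrix whose only nonzero entries are a
skew-symmetric tridiagonal `3 × 3` block and the entries at positions `(2, 3)` and `(3, 0)`. -/
lemma charpoly_skew_tridiagonal_bordered {R : Type*} [CommRing R] (n k a b : R) :
    (!![0, -n, 0, 0; n, 0, k, 0; 0, -k, 0, a; -b, 0, 0, 0] : Matrix (Fin 4) (Fin 4) R).charpoly =
      X ^ 4 + C (k ^ 2 + n ^ 2) * X ^ 2 - C (n * k * a * b) := by
  simp [Matrix.charpoly, Matrix.charmatrix_apply, Matrix.det_succ_row_zero, Fin.sum_univ_succ,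
    Fin.succAbove, Matrix.diagonal_apply]
  ring

/-- For `κ > 0` and `ξ ∈ ℝ³ \ {0}`, the characteristic polynomial of the
Fourier symbol `M(ξ)` of the linearized rotating compressible Euler system equals
`τ⁴ + (κ⁻² + |ξ|²)τ² + κ⁻²ξ₃²`. -/
theorem charpoly_linearized_symbol (κ ξ₁ ξ₂ ξ₃ : ℝ) (hκ : 0 < κ)
    (hξ : ¬(ξ₁ = 0 ∧ ξ₂ = 0 ∧ ξ₃ = 0)) :
    let n : ℝ := Real.sqrt (ξ₁ ^ 2 + ξ₂ ^ 2 + ξ₃ ^ 2)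
    let M : Matrix (Fin 4) (Fin 4) ℂ :=
      !![0, -(n : ℂ), 0, 0;
         (n : ℂ), 0, (κ⁻¹ : ℝ), 0;
         0, -((κ⁻¹ : ℝ) : ℂ), 0, Complex.I * (κ⁻¹ : ℝ) * (ξ₃ : ℂ) / (n : ℂ);
         -Complex.I * (ξ₃ : ℂ), 0, 0, 0]
    M.charpoly = X ^ 4 + C (((κ⁻¹ ^ 2 + n ^ 2 : ℝ) : ℂ)) * X ^ 2
      + C (((κ⁻¹ ^ 2 * ξ₃ ^ 2 : ℝ) : ℂ)) := by
  intro n M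
  have hn : (n : ℂ) ≠ 0 := by
    rw [Complex.ofReal_ne_zero]
    refine (Real.sqrt_pos.mpr ?_).ne'
    by_contra! h
    refine hξ ⟨?_, ?_, ?_⟩ <;> nlinarith [sq_nonneg ξ₁, sq_nonneg ξ₂, sq_nonneg ξ₃]
  have hcycle : (n : ℂ) * (κ⁻¹ : ℝ) * (Complex.I * (κ⁻¹ : ℝ) * ξ₃ / n) * (Complex.I * ξ₃) =
      -((κ⁻¹ ^ 2 * ξ₃ ^ 2 : ℝ) : ℂ) := by
    push_cast
    field_simp
    simp [neg_div]
  have h := charpoly_skew_tridiagonal_bordered (n : ℂ) ((κ⁻¹ : ℝ) : ℂ)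
    (Complex.I * (κ⁻¹ : ℝ) * ξ₃ / n) (Complex.I * ξ₃)
  rw [hcycle, C_neg, sub_neg_eq_add, ← neg_mul] at h
  simpa only [M, Complex.ofReal_add, Complex.ofReal_pow] using h
end

section
/- There exists a constant C > 0 such that for all κ > 0 and all ξ = (ξ₁,ξ₂,ξ₃) ∈ ℝ³ with κ|ξ| ≥ 1 one has |Σ_κ(ξ) − |ξ|| ≤ C·κ⁻²·|ξ|⁻¹ and |κ·Ω_κ(ξ) − ξ₃/|ξ|| ≤ C·(|ξ₃|/|ξ|)·(κ|ξ|)⁻². (In the high-frequency regime, Σ_κ behaves like the sound wave relation |ξ| and κΩ_κ like the inertial wave relation ξ₃/|ξ|, with relative errors O((κ|ξ|)⁻²).) -/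
noncomputable section

/-- `d₁(ξ) = √(ξ₁² + ξ₂² + (ξ₃ − κ⁻¹)²)`, the distance from `ξ` to `(0,0,κ⁻¹)`. -/
def d1 (κ ξ₁ ξ₂ ξ₃ : ℝ) : ℝ := Real.sqrt (ξ₁ ^ 2 + ξ₂ ^ 2 + (ξ₃ - κ⁻¹) ^ 2)

/-- `d₂(ξ) = √(ξ₁² + ξ₂² + (ξ₃ + κ⁻¹)²)`, the distance from `ξ` to `(0,0,−κ⁻¹)`. -/
def d2 (κ ξ₁ ξ₂ ξ₃ : ℝ) : ℝ := Real.sqrt (ξ₁ ^ 2 + ξ₂ ^ 2 + (ξ₃ + κ⁻¹) ^ 2)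

/-- `Σ_κ(ξ) = (d₂(ξ) + d₁(ξ))/2`, the sound wave dispersion relation. -/
def Sig (κ ξ₁ ξ₂ ξ₃ : ℝ) : ℝ := (d2 κ ξ₁ ξ₂ ξ₃ + d1 κ ξ₁ ξ₂ ξ₃) / 2

/-- `Ω_κ(ξ) = (d₂(ξ) − d₁(ξ))/2`, the inertial wave dispersion relation. -/
def Om (κ ξ₁ ξ₂ ξ₃ : ℝ) : ℝ := (d2 κ ξ₁ ξ₂ ξ₃ - d1 κ ξ₁ ξ₂ ξ₃) / 2

/-- The Euclidean norm `|ξ|` of `ξ ∈ ℝ³`. -/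
def nrm3 (ξ₁ ξ₂ ξ₃ : ℝ) : ℝ := Real.sqrt (ξ₁ ^ 2 + ξ₂ ^ 2 + ξ₃ ^ 2)

/-- The horizontal norm `|ξ_h| = √(ξ₁² + ξ₂²)`. -/
def nrmh (ξ₁ ξ₂ : ℝ) : ℝ := Real.sqrt (ξ₁ ^ 2 + ξ₂ ^ 2)

lemma nrm3_sq (ξ₁ ξ₂ ξ₃ : ℝ) : nrm3 ξ₁ ξ₂ ξ₃ ^ 2 = ξ₁ ^ 2 + ξ₂ ^ 2 + ξ₃ ^ 2 :=
  Real.sq_sqrt (by positivity)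

lemma d1_sq (κ ξ₁ ξ₂ ξ₃ : ℝ) :
    d1 κ ξ₁ ξ₂ ξ₃ ^ 2 = ξ₁ ^ 2 + ξ₂ ^ 2 + (ξ₃ - κ⁻¹) ^ 2 :=
  Real.sq_sqrt (by positivity)

lemma d2_sq (κ ξ₁ ξ₂ ξ₃ : ℝ) :
    d2 κ ξ₁ ξ₂ ξ₃ ^ 2 = ξ₁ ^ 2 + ξ₂ ^ 2 + (ξ₃ + κ⁻¹) ^ 2 :=
  Real.sq_sqrt (by positivity)

lemma Sig_mul_Om (κ ξ₁ ξ₂ ξ₃ : ℝ) : Sig κ ξ₁ ξ₂ ξ₃ * Om κ ξ₁ ξ₂ ξ₃ = κ⁻¹ * ξ₃ := by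
  unfold Sig Om
  linear_combination (d2_sq κ ξ₁ ξ₂ ξ₃ - d1_sq κ ξ₁ ξ₂ ξ₃) / 4

lemma Sig_sq_add_Om_sq (κ ξ₁ ξ₂ ξ₃ : ℝ) :
    Sig κ ξ₁ ξ₂ ξ₃ ^ 2 + Om κ ξ₁ ξ₂ ξ₃ ^ 2 = nrm3 ξ₁ ξ₂ ξ₃ ^ 2 + κ⁻¹ ^ 2 := by
  unfold Sig Om
  linear_combination (d2_sq κ ξ₁ ξ₂ ξ₃ + d1_sq κ ξ₁ ξ₂ ξ₃) / 2 - nrm3_sq ξ₁ ξ₂ ξ₃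

lemma Sig_nonneg (κ ξ₁ ξ₂ ξ₃ : ℝ) : 0 ≤ Sig κ ξ₁ ξ₂ ξ₃ := by
  unfold Sig d1 d2
  positivity

lemma nrm3_le_Sig (κ ξ₁ ξ₂ ξ₃ : ℝ) : nrm3 ξ₁ ξ₂ ξ₃ ≤ Sig κ ξ₁ ξ₂ ξ₃ := by
  have hprod : nrm3 ξ₁ ξ₂ ξ₃ ^ 2 - κ⁻¹ ^ 2 ≤ d1 κ ξ₁ ξ₂ ξ₃ * d2 κ ξ₁ ξ₂ ξ₃ := by
    refine le_of_abs_le (abs_le_of_sq_le_sq ?_ ?_)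
    · rw [mul_pow, d1_sq, d2_sq, nrm3_sq]
      nlinarith [mul_nonneg (sq_nonneg κ⁻¹) (add_nonneg (sq_nonneg ξ₁) (sq_nonneg ξ₂))]
    · exact mul_nonneg (Real.sqrt_nonneg _) (Real.sqrt_nonneg _)
  refine le_of_abs_le (abs_le_of_sq_le_sq ?_ (Sig_nonneg κ ξ₁ ξ₂ ξ₃))
  unfold Sig
  nlinarith [d1_sq κ ξ₁ ξ₂ ξ₃, d2_sq κ ξ₁ ξ₂ ξ₃, nrm3_sq ξ₁ ξ₂ ξ₃]

lemma Sig_sub_nrm3_le {κ ξ₁ ξ₂ ξ₃ : ℝ} (hn : 0 < nrm3 ξ₁ ξ₂ ξ₃) :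
    Sig κ ξ₁ ξ₂ ξ₃ - nrm3 ξ₁ ξ₂ ξ₃ ≤ κ⁻¹ ^ 2 * (nrm3 ξ₁ ξ₂ ξ₃)⁻¹ := by
  rw [← div_eq_mul_inv, le_div_iff₀ hn]
  nlinarith [nrm3_le_Sig κ ξ₁ ξ₂ ξ₃, Sig_sq_add_Om_sq κ ξ₁ ξ₂ ξ₃, sq_nonneg (Om κ ξ₁ ξ₂ ξ₃)]

/-- In the high-frequency regime `κ|ξ| ≥ 1`, `Σ_κ` behaves like the sound
wave relation `|ξ|` and `κΩ_κ` like the inertial wave relation `ξ₃/|ξ|`, with relative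
errors `O((κ|ξ|)⁻²)`. -/
theorem dispersion_relations_high_frequency_asymptotics :
    ∃ C > 0, ∀ κ ξ₁ ξ₂ ξ₃ : ℝ, 0 < κ → 1 ≤ κ * nrm3 ξ₁ ξ₂ ξ₃ →
      |Sig κ ξ₁ ξ₂ ξ₃ - nrm3 ξ₁ ξ₂ ξ₃| ≤ C * κ⁻¹ ^ 2 * (nrm3 ξ₁ ξ₂ ξ₃)⁻¹ ∧
      |κ * Om κ ξ₁ ξ₂ ξ₃ - ξ₃ / nrm3 ξ₁ ξ₂ ξ₃|
        ≤ C * (|ξ₃| / nrm3 ξ₁ ξ₂ ξ₃) * ((κ * nrm3 ξ₁ ξ₂ ξ₃)⁻¹) ^ 2 := by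
  refine ⟨1, one_pos, fun κ ξ₁ ξ₂ ξ₃ hκ h ↦ ?_⟩
  have hn : 0 < nrm3 ξ₁ ξ₂ ξ₃ := pos_of_mul_pos_right (one_pos.trans_le h) hκ.le
  have hle := nrm3_le_Sig κ ξ₁ ξ₂ ξ₃
  have hub := Sig_sub_nrm3_le (κ := κ) hn
  have hmul := Sig_mul_Om κ ξ₁ ξ₂ ξ₃
  generalize nrm3 ξ₁ ξ₂ ξ₃ = n at *
  generalize Sig κ ξ₁ ξ₂ ξ₃ = s at *
  have hs : 0 < s := hn.trans_le hle
  refine ⟨by rwa [abs_of_nonneg (sub_nonneg.2 hle), one_mul], ?_⟩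
  have hOm : κ * Om κ ξ₁ ξ₂ ξ₃ = ξ₃ / s := by
    rw [eq_div_iff hs.ne', mul_assoc, mul_comm _ s, hmul, mul_inv_cancel_left₀ hκ.ne']
  have hdiff : ξ₃ / s - ξ₃ / n = -(ξ₃ / n * ((s - n) / s)) := by
    field_simp
    ring
  rw [hOm, hdiff, abs_neg, abs_mul, abs_div, abs_of_pos hn, one_mul,
    abs_of_nonneg (div_nonneg (sub_nonneg.2 hle) hs.le)]
  refine mul_le_mul_of_nonneg_left ?_ (by positivity)
  calc (s - n) / s ≤ κ⁻¹ ^ 2 * n⁻¹ / n := div_le_div₀ (by positivity) hub hn hle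
    _ = ((κ * n)⁻¹) ^ 2 := by
      field_simp
end
end

section
/- For all t > 0, c > 0, κ > 0 and all ρ with 0 < ρ < 2κ⁻¹, one has the exact evaluation ∫₀^π exp((i·t·c/2)·√(ρ² + 4κ⁻² + 4κ⁻¹·ρ·cos φ))·sin φ dφ = e^{i·t·c·κ⁻¹}·[ (4i·sin(tcρ/2) + 2ρκ·cos(tcρ/2))/(i·t·c·ρ) + (4κ·i·sin(tcρ/2))/(t²·c²·ρ) ]. -/
open Real

/-- A primitive of `u * exp (I * a * u)`. -/
theorem hasDerivAt_exp_mul_primitive {a : ℝ} (ha : a ≠ 0) (u : ℝ) :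
    HasDerivAt (fun v : ℝ => Complex.exp (Complex.I * ((a * v : ℝ) : ℂ))
        * ((v : ℂ) / (Complex.I * a) + 1 / (a : ℂ) ^ 2))
      (Complex.exp (Complex.I * ((a * u : ℝ) : ℂ)) * u) u := by
  have ha' : (a : ℂ) ≠ 0 := Complex.ofReal_ne_zero.mpr ha
  have hlin : HasDerivAt (fun v : ℝ => Complex.I * ((a * v : ℝ) : ℂ)) (Complex.I * a) u := by
    simpa using (((hasDerivAt_id u).const_mul a).ofReal_comp).const_mul Complex.I
  have haff : HasDerivAt (fun v : ℝ => (v : ℂ) / (Complex.I * a) + 1 / (a : ℂ) ^ 2)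
      (1 / (Complex.I * a)) u := by
    simpa using (((hasDerivAt_id u).ofReal_comp).div_const (Complex.I * a)).add_const
      (1 / (a : ℂ) ^ 2)
  refine (hlin.cexp.mul haff).congr_deriv ?_
  have hI := Complex.I_ne_zero
  field_simp
  linear_combination Complex.I_sq

/-- The radicand of the shifted dispersion relation is positive away from the sphere of radius
`b` centered at the origin. -/
theorem radicand_pos {ρ b : ℝ} (hρ : 0 < ρ) (hb : ρ < b) (φ : ℝ) :
    0 < ρ ^ 2 + b ^ 2 + 2 * b * ρ * Real.cos φ := by
  have hmul : 0 ≤ b * ρ * (1 + Real.cos φ) :=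
    mul_nonneg (mul_pos (hρ.trans hb) hρ).le (by linarith [Real.neg_one_le_cos φ])
  nlinarith [pow_pos (sub_pos.mpr hb) 2]

theorem hasDerivAt_sqrt_radicand {ρ b : ℝ} (hρ : 0 < ρ) (hb : ρ < b) (φ : ℝ) :
    HasDerivAt (fun ψ : ℝ => √(ρ ^ 2 + b ^ 2 + 2 * b * ρ * Real.cos ψ))
      (-(b * ρ * Real.sin φ) / √(ρ ^ 2 + b ^ 2 + 2 * b * ρ * Real.cos φ)) φ := by
  convert (((Real.hasDerivAt_cos φ).const_mul (2 * b * ρ)).const_add (ρ ^ 2 + b ^ 2)).sqrt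
    (radicand_pos hρ hb φ).ne' using 1
  have hs := (Real.sqrt_pos.mpr (radicand_pos hρ hb φ)).ne'
  field_simp

/-- The angular integral in terms of the values of the primitive at `b + ρ` and `b - ρ`. -/
theorem integral_exp_sqrt_radicand_mul_sin {a ρ b : ℝ} (ha : a ≠ 0) (hρ : 0 < ρ) (hb : ρ < b) :
    (∫ φ in (0 : ℝ)..Real.pi,
        Complex.exp (Complex.I * ((a * √(ρ ^ 2 + b ^ 2 + 2 * b * ρ * Real.cos φ) : ℝ) : ℂ))
          * ((Real.sin φ : ℝ) : ℂ))
      = (Complex.exp (Complex.I * ((a * (b + ρ) : ℝ) : ℂ))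
            * (((b + ρ : ℝ) : ℂ) / (Complex.I * a) + 1 / (a : ℂ) ^ 2)
          - Complex.exp (Complex.I * ((a * (b - ρ) : ℝ) : ℂ))
            * (((b - ρ : ℝ) : ℂ) / (Complex.I * a) + 1 / (a : ℂ) ^ 2)) / (b * ρ) := by
  have hb0 : 0 < b := hρ.trans hb
  have hbc : (b : ℂ) ≠ 0 := Complex.ofReal_ne_zero.mpr hb0.ne'
  have hρc : (ρ : ℂ) ≠ 0 := Complex.ofReal_ne_zero.mpr hρ.ne'
  have hderiv : ∀ φ ∈ Set.uIcc 0 Real.pi, HasDerivAt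
      (fun ψ : ℝ => (-1 / (b * ρ) : ℂ) *
        (Complex.exp (Complex.I * ((a * √(ρ ^ 2 + b ^ 2 + 2 * b * ρ * Real.cos ψ) : ℝ) : ℂ))
          * ((√(ρ ^ 2 + b ^ 2 + 2 * b * ρ * Real.cos ψ) : ℂ) / (Complex.I * a)
            + 1 / (a : ℂ) ^ 2)))
      (Complex.exp (Complex.I * ((a * √(ρ ^ 2 + b ^ 2 + 2 * b * ρ * Real.cos φ) : ℝ) : ℂ))
          * ((Real.sin φ : ℝ) : ℂ)) φ := by
    intro φ _
    have hs : (√(ρ ^ 2 + b ^ 2 + 2 * b * ρ * Real.cos φ) : ℂ) ≠ 0 :=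
      Complex.ofReal_ne_zero.mpr (Real.sqrt_pos.mpr (radicand_pos hρ hb φ)).ne'
    refine (((hasDerivAt_exp_mul_primitive ha _).scomp φ
      (hasDerivAt_sqrt_radicand hρ hb φ)).const_mul (-1 / (b * ρ) : ℂ)).congr_deriv ?_
    rw [Complex.real_smul, Complex.ofReal_div, Complex.ofReal_neg, Complex.ofReal_mul,
      Complex.ofReal_mul]
    generalize √(ρ ^ 2 + b ^ 2 + 2 * b * ρ * Real.cos φ) = r at hs ⊢
    field_simp
  rw [intervalIntegral.integral_eq_sub_of_hasDerivAt hderiv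
    (Continuous.intervalIntegrable (by fun_prop) _ _)]
  have hsqrt_pi : √(ρ ^ 2 + b ^ 2 + 2 * b * ρ * Real.cos Real.pi) = b - ρ := by
    rw [Real.cos_pi, show ρ ^ 2 + b ^ 2 + 2 * b * ρ * (-1) = (b - ρ) ^ 2 by ring,
      Real.sqrt_sq (sub_pos.mpr hb).le]
  have hsqrt_zero : √(ρ ^ 2 + b ^ 2 + 2 * b * ρ * Real.cos 0) = b + ρ := by
    rw [Real.cos_zero, show ρ ^ 2 + b ^ 2 + 2 * b * ρ * 1 = (b + ρ) ^ 2 by ring,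
      Real.sqrt_sq (add_pos hb0 hρ).le]
  rw [hsqrt_pi, hsqrt_zero]
  ring

/-- Euler's formula with a shifted phase. -/
theorem exp_I_mul_add (x y : ℝ) :
    Complex.exp (Complex.I * ((x + y : ℝ) : ℂ)) = Complex.exp (Complex.I * (x : ℂ))
      * (((Real.cos y : ℝ) : ℂ) + ((Real.sin y : ℝ) : ℂ) * Complex.I) := by
  rw [Complex.ofReal_add, mul_add, Complex.exp_add, mul_comm Complex.I (y : ℂ),
    Complex.exp_mul_I, Complex.ofReal_cos, Complex.ofReal_sin]

/-- Exact evaluation of the angular part, in spherical coordinates centered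
at `(0,0,κ⁻¹)`, of the oscillatory integral `∫ e^{itcΣ_κ(ξ)}g(ξ)dξ` for radial `g`. -/
theorem angular_integral_exact (t c κ ρ : ℝ) (ht : 0 < t) (hc : 0 < c) (hκ : 0 < κ)
    (hρ : 0 < ρ) (hρ' : ρ < 2 * κ⁻¹) :
    (∫ φ in (0 : ℝ)..Real.pi,
        Complex.exp (Complex.I * (((t * c / 2)
            * Real.sqrt (ρ ^ 2 + 4 * κ⁻¹ ^ 2 + 4 * κ⁻¹ * ρ * Real.cos φ) : ℝ) : ℂ))
          * ((Real.sin φ : ℝ) : ℂ))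
      = Complex.exp (Complex.I * ((t * c * κ⁻¹ : ℝ) : ℂ)) *
        ((4 * Complex.I * ((Real.sin (t * c * ρ / 2) : ℝ) : ℂ)
            + 2 * (ρ : ℂ) * (κ : ℂ) * ((Real.cos (t * c * ρ / 2) : ℝ) : ℂ))
              / (Complex.I * (t : ℂ) * (c : ℂ) * (ρ : ℂ))
          + (4 * (κ : ℂ) * Complex.I * ((Real.sin (t * c * ρ / 2) : ℝ) : ℂ))
              / ((t : ℂ) ^ 2 * (c : ℂ) ^ 2 * (ρ : ℂ))) := by
  have htc : (t : ℂ) ≠ 0 := Complex.ofReal_ne_zero.mpr ht.ne'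
  have hcc : (c : ℂ) ≠ 0 := Complex.ofReal_ne_zero.mpr hc.ne'
  have hκc : (κ : ℂ) ≠ 0 := Complex.ofReal_ne_zero.mpr hκ.ne'
  have hρc : (ρ : ℂ) ≠ 0 := Complex.ofReal_ne_zero.mpr hρ.ne'
  have hI := Complex.I_ne_zero
  have hint := integral_exp_sqrt_radicand_mul_sin (a := t * c / 2) (by positivity) hρ hρ'
  rw [show t * c / 2 * (2 * κ⁻¹ + ρ) = t * c * κ⁻¹ + t * c * ρ / 2 by ring,
    show t * c / 2 * (2 * κ⁻¹ - ρ) = t * c * κ⁻¹ + -(t * c * ρ / 2) by ring,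
    exp_I_mul_add, exp_I_mul_add, Real.cos_neg, Real.sin_neg] at hint
  have hrad : ∀ φ : ℝ, ρ ^ 2 + 4 * κ⁻¹ ^ 2 + 4 * κ⁻¹ * ρ * Real.cos φ
      = ρ ^ 2 + (2 * κ⁻¹) ^ 2 + 2 * (2 * κ⁻¹) * ρ * Real.cos φ := fun φ => by ring
  simp_rw [hrad]
  rw [hint]
  generalize Complex.exp (Complex.I * ((t * c * κ⁻¹ : ℝ) : ℂ)) = E
  generalize Real.sin (t * c * ρ / 2) = S
  generalize Real.cos (t * c * ρ / 2) = C
  push_cast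
  field_simp
  ring
end
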